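/- arXiv:1312.4310 — 3 statements merged into one kernel-verified Lean document; each statement's English description precedes it below -/
import Mathlib

section
/- Let A be a commutative group written multiplicatively, G a commutative group written additively, f : G × G → A a normalized 2-cocycle, and H a subgroup of G such that f(h₁,h₂) = 1 for all h₁, h₂ ∈ H. Then the subgroup {(1,h) : h ∈ H} of (A×G)_f (the image of the canonical splitting over H) is a normal subgroup of (A×G)_f if and only if f(g,h) = f(h,g) for all g ∈ G and h ∈ H. -/
/-- The multiplication `(a₁,g₁)(a₂,g₂) = (a₁·a₂·f(g₁,g₂), g₁+g₂)` on `A × G`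
associated to a 2-cocycle `f : G × G → A`. -/
def cocMul {A G : Type*} [CommGroup A] [AddCommGroup G] (f : G → G → A)
    (p q : A × G) : A × G :=
  (p.1 * q.1 * f p.2 q.2, p.2 + q.2)

/-- A normalized 2-cocycle takes the same value at `(g, -g)` and `(-g, g)`. -/
theorem cocycle_neg_comm {A G : Type*} [CommGroup A] [AddCommGroup G] {f : G → G → A}
    (hl : ∀ g : G, f 0 g = 1) (hr : ∀ g : G, f g 0 = 1)
    (hcoc : ∀ g₁ g₂ g₃ : G, f g₁ g₂ * f (g₁ + g₂) g₃ = f g₂ g₃ * f g₁ (g₂ + g₃)) (g : G) :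
    f g (-g) = f (-g) g := by
  simpa [hl, hr] using hcoc g (-g) g

theorem cocycle_mul_neg_eq_iff {A G : Type*} [CommGroup A] [AddCommGroup G] {f : G → G → A}
    (hr : ∀ g : G, f g 0 = 1)
    (hcoc : ∀ g₁ g₂ g₃ : G, f g₁ g₂ * f (g₁ + g₂) g₃ = f g₂ g₃ * f g₁ (g₂ + g₃)) (g h : G) :
    f g h * f (g + h) (-g) = f g (-g) ↔ f g h = f h g := by
  have key : f h g * f (g + h) (-g) = f g (-g) := by
    simpa [hr, add_comm h g] using hcoc h g (-g)
  rw [← key, mul_left_inj]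

/-- If `f : G × G → A` is a normalized 2-cocycle which is trivial on a subgroup `H` of
`G`, then the subgroup `{(1,h) : h ∈ H}` of `(A×G)_f` (the image of the canonical
splitting over `H`) is normal — i.e. stable under conjugation `p·(1,h)·p⁻¹` by any
element `p` with inverse `p'` — if and only if `f(g,h) = f(h,g)` for all `g ∈ G` and
`h ∈ H`. -/
theorem stmt_8 {A G : Type*} [CommGroup A] [AddCommGroup G] (f : G → G → A)
    (hl : ∀ g : G, f 0 g = 1) (hr : ∀ g : G, f g 0 = 1)
    (hcoc : ∀ g₁ g₂ g₃ : G, f g₁ g₂ * f (g₁ + g₂) g₃ = f g₂ g₃ * f g₁ (g₂ + g₃))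
    (H : AddSubgroup G) (hH : ∀ h₁ ∈ H, ∀ h₂ ∈ H, f h₁ h₂ = 1) :
    (∀ p p' : A × G,
        cocMul f p p' = ((1 : A), (0 : G)) → cocMul f p' p = ((1 : A), (0 : G)) →
        ∀ h ∈ H, ∃ h' ∈ H,
          cocMul f (cocMul f p (((1 : A), h) : A × G)) p' = (((1 : A), h') : A × G)) ↔
      (∀ g : G, ∀ h ∈ H, f g h = f h g) := by
  constructor
  · intro hN g h hh
    obtain ⟨h', -, e⟩ := hN (1, g) ((f g (-g))⁻¹, -g) (by simp [cocMul])
      (by simp [cocMul, cocycle_neg_comm hl hr hcoc g]) h hh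
    have e₁ := congrArg Prod.fst e
    simp only [cocMul, one_mul, mul_one] at e₁
    rw [← cocycle_mul_neg_eq_iff hr hcoc]
    rwa [mul_right_comm, mul_inv_eq_one] at e₁
  · rintro hC ⟨a, g⟩ ⟨b, g'⟩ hp - h hh
    simp only [cocMul, Prod.mk.injEq] at hp
    obtain ⟨hab, hg⟩ := hp
    obtain rfl : g' = -g := (neg_eq_of_add_eq_zero_right hg).symm
    refine ⟨h, hh, ?_⟩
    have key := (cocycle_mul_neg_eq_iff hr hcoc g h).mpr (hC g h hh)
    simp only [cocMul, mul_one, Prod.mk.injEq]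
    refine ⟨?_, by abel⟩
    rw [← hab, ← key]
    simp only [mul_assoc, mul_left_comm]
end

section
/- Let G be a commutative group, let d, n be positive integers, set a = gcd(d,n) and e = n/a. Assume that for every x ∈ G with x^a = 1 there exists u ∈ G with u^n = 1 and u^e = x (i.e. the e-th power map from n-th roots of unity in G onto a-th roots of unity in G is surjective). Then every g ∈ G such that g^d is an n-th power in G is itself an e-th power in G. -/
/-- In a commutative group, if `g ^ k` is an `e`-th power with `k` coprime to `e`, then `g` is
itself an `e`-th power. -/
theorem exists_eq_pow_of_pow_eq_pow_of_coprime {G : Type*} [CommGroup G] {k e : ℕ}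
    (hke : k.Coprime e) {g y : G} (h : g ^ k = y ^ e) : ∃ w : G, g = w ^ e := by
  have hbez : (k : ℤ) * k.gcdA e + e * k.gcdB e = 1 := by
    rw [← Nat.gcd_eq_gcd_ab, hke.gcd_eq_one, Nat.cast_one]
  refine ⟨y ^ k.gcdA e * g ^ k.gcdB e, ?_⟩
  calc g = g ^ ((k : ℤ) * k.gcdA e + e * k.gcdB e) := by rw [hbez, zpow_one]
    _ = (y ^ e) ^ k.gcdA e * (g ^ e) ^ k.gcdB e := by
      rw [zpow_add, zpow_mul, zpow_mul, zpow_natCast, zpow_natCast, h]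
    _ = (y ^ k.gcdA e * g ^ k.gcdB e) ^ e := by
      rw [mul_pow, ← zpow_natCast (y ^ _), ← zpow_natCast (g ^ k.gcdB e), zpow_comm y,
        zpow_comm g, zpow_natCast, zpow_natCast]

/-- Let `G` be a commutative group, `d, n` positive integers, `a = gcd(d,n)` and
`e = n / a`.  If the `e`-th power map from `n`-th roots of unity in `G` onto `a`-th
roots of unity in `G` is surjective, then every `g ∈ G` such that `g^d` is an `n`-th
power in `G` is itself an `e`-th power in `G`. -/
theorem stmt_10 {G : Type*} [CommGroup G] (d n : ℕ) (hd : 0 < d) (hn : 0 < n)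
    (hsurj : ∀ x : G, x ^ Nat.gcd d n = 1 →
      ∃ u : G, u ^ n = 1 ∧ u ^ (n / Nat.gcd d n) = x)
    (g z : G) (h : g ^ d = z ^ n) :
    ∃ w : G, g = w ^ (n / Nat.gcd d n) := by
  have hroot : (g ^ (d / d.gcd n) / z ^ (n / d.gcd n)) ^ d.gcd n = 1 := by
    rw [div_pow, ← pow_mul, ← pow_mul, Nat.div_mul_cancel (Nat.gcd_dvd_left d n),
      Nat.div_mul_cancel (Nat.gcd_dvd_right d n), h, div_self']
  obtain ⟨u, -, hu⟩ := hsurj _ hroot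
  refine exists_eq_pow_of_pow_eq_pow_of_coprime (y := u * z)
    (Nat.coprime_div_gcd_div_gcd (Nat.gcd_pos_of_pos_left n hd)) ?_
  rw [mul_pow, hu, div_mul_cancel]
end

section
/- Let M be a commutative group written multiplicatively, r a positive integer, and c : Fin r → ℤ a family of integers not all zero with greatest common divisor m. Then the kernel of the group homomorphism M^r → M given by x ↦ ∏_i x_i^{c_i} is isomorphic, as a group, to the product {x ∈ M : x^m = 1} × M^{r−1} of the m-torsion subgroup of M with r−1 copies of M. -/
/-- The group homomorphism `M^r → M`, `x ↦ ∏_i x_i^{c_i}`. -/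
def powProdHom {M : Type*} [CommGroup M] {r : ℕ} (c : Fin r → ℤ) :
    (Fin r → M) →* M where
  toFun x := ∏ i : Fin r, x i ^ c i
  map_one' := by simp
  map_mul' x y := by simp [mul_zpow, Finset.prod_mul_distrib]

/-- The `m`-torsion subgroup `{x ∈ M : x^m = 1}` of a commutative group `M`. -/
def torsionSub (M : Type*) [CommGroup M] (m : ℕ) : Subgroup M where
  carrier := {x : M | x ^ m = 1}
  one_mem' := by simp
  mul_mem' := by
    intro a b ha hb
    simp only [Set.mem_setOf_eq] at *
    rw [mul_pow, ha, hb, mul_one]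
  inv_mem' := by
    intro a ha
    simp only [Set.mem_setOf_eq] at *
    rw [inv_pow, ha, inv_one]

/-- Splitting off the first coordinate, `M^{n+1} ≃* M × M^n`. -/
def piFinSuccMulEquiv (M : Type*) [Mul M] (n : ℕ) :
    (Fin (n + 1) → M) ≃* M × (Fin n → M) where
  toFun x := (x 0, Fin.tail x)
  invFun p := Fin.cons p.1 p.2
  left_inv x := Fin.cons_self_tail x
  right_inv p := by simp
  map_mul' _ _ := rfl

/-- The automorphism of `M × M` given by an integer matrix `!![a, b; -t, s]` of
determinant one. -/
def prodMulEquivOfDetOne (M : Type*) [CommGroup M] {a b s t : ℤ} (h : s * a + t * b = 1) :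
    M × M ≃* M × M where
  toFun p := (p.1 ^ a * p.2 ^ b, p.1 ^ (-t) * p.2 ^ s)
  invFun p := (p.1 ^ s * p.2 ^ (-b), p.1 ^ t * p.2 ^ a)
  left_inv p := by
    ext <;> dsimp only <;>
      rw [mul_zpow, mul_zpow, ← zpow_mul, ← zpow_mul, ← zpow_mul, ← zpow_mul,
        mul_mul_mul_comm, ← zpow_add, ← zpow_add]
    · rw [show a * s + -t * -b = 1 by linarith, show b * s + s * -b = 0 by ring]
      simp
    · rw [show a * t + -t * a = 0 by ring, show b * t + s * a = 1 by linarith]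
      simp
  right_inv p := by
    ext <;> dsimp only <;>
      rw [mul_zpow, mul_zpow, ← zpow_mul, ← zpow_mul, ← zpow_mul, ← zpow_mul,
        mul_mul_mul_comm, ← zpow_add, ← zpow_add]
    · rw [show s * a + t * b = 1 by linarith, show -b * a + a * b = 0 by ring]
      simp
    · rw [show s * -t + t * s = 0 by ring, show -b * -t + a * s = 1 by linarith]
      simp
  map_mul' p q := by
    ext <;> simp only [Prod.fst_mul, Prod.snd_mul, mul_zpow, mul_mul_mul_comm]

theorem Int.exists_eq_gcd_mul_and_bezout (a b : ℤ) :
    ∃ a' b' s t : ℤ, a = a' * Int.gcd a b ∧ b = b' * Int.gcd a b ∧ s * a' + t * b' = 1 := by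
  rcases Nat.eq_zero_or_pos (Int.gcd a b) with h | h
  · obtain ⟨rfl, rfl⟩ := Int.gcd_eq_zero_iff.mp h
    exact ⟨1, 0, 1, 0, by simp⟩
  · obtain ⟨a', b', hab, ha, hb⟩ := Int.exists_gcd_one h
    obtain ⟨s, t, hst⟩ := Int.isCoprime_iff_gcd_eq_one.mpr hab
    exact ⟨a', b', s, t, ha, hb, hst⟩

theorem exists_mulEquiv_zpow_mul_zpow (M : Type*) [CommGroup M] (a b : ℤ) :
    ∃ e : M × M ≃* M × M, ∀ p, p.1 ^ a * p.2 ^ b = (e p).1 ^ (Int.gcd a b : ℤ) := by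
  obtain ⟨a', b', s, t, ha, hb, h⟩ := Int.exists_eq_gcd_mul_and_bezout a b
  refine ⟨prodMulEquivOfDetOne M h, fun p => ?_⟩
  change _ = (p.1 ^ a' * p.2 ^ b') ^ (Int.gcd a b : ℤ)
  rw [mul_zpow, ← zpow_mul, ← zpow_mul, ← ha, ← hb]

/-- After an automorphism of `M^{n+1}`, the map `x ↦ ∏_i x_i^{c_i}` becomes the power map
by a greatest common divisor of `c` on one coordinate. -/
theorem exists_mulEquiv_powProdHom_eq (M : Type*) [CommGroup M] (n : ℕ)
    (c : Fin (n + 1) → ℤ) :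
    ∃ (g : ℤ) (φ : (Fin (n + 1) → M) ≃* M × (Fin n → M)),
      (∀ k : ℤ, k ∣ g ↔ ∀ i, k ∣ c i) ∧ ∀ x, powProdHom c x = (φ x).1 ^ g := by
  induction n with
  | zero =>
    exact ⟨c 0, piFinSuccMulEquiv M 0, by simp,
      fun x => Fin.prod_univ_one fun i => x i ^ c i⟩
  | succ n ih =>
    obtain ⟨g, ψ, hg, hψ⟩ := ih (Fin.tail c)
    obtain ⟨e, he⟩ := exists_mulEquiv_zpow_mul_zpow M (c 0) g
    refine ⟨Int.gcd (c 0) g,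
      (piFinSuccMulEquiv M (n + 1)).trans <|
        ((MulEquiv.refl M).prodCongr ψ).trans <|
        MulEquiv.prodAssoc.symm.trans <|
        (e.prodCongr (MulEquiv.refl (Fin n → M))).trans <|
        MulEquiv.prodAssoc.trans <|
        (MulEquiv.refl M).prodCongr (piFinSuccMulEquiv M n).symm, fun k => ?_, fun x => ?_⟩
    · rw [Int.dvd_coe_gcd_iff, hg, Fin.forall_fin_succ (P := fun i => k ∣ c i)]
      rfl
    · have h₁ : powProdHom c x = x 0 ^ c 0 * powProdHom (Fin.tail c) (Fin.tail x) :=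
        Fin.prod_univ_succ _
      rw [h₁, hψ]
      exact he (x 0, (ψ (Fin.tail x)).1)

/-- Let `M` be a commutative group, `r` a positive integer and `c : Fin r → ℤ` a family
of integers, not all zero, with greatest common divisor `m`.  Then the kernel of the
homomorphism `M^r → M`, `x ↦ ∏_i x_i^{c_i}`, is isomorphic as a group to the product
`{x ∈ M : x^m = 1} × M^{r−1}`. -/
theorem stmt_16 {M : Type*} [CommGroup M] (r : ℕ) (hr : 0 < r) (c : Fin r → ℤ)
    (hc : ∃ i, c i ≠ 0) (m : ℕ)
    (hm₁ : ∀ i, (m : ℤ) ∣ c i)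
    (hm₂ : ∀ k : ℤ, (∀ i, k ∣ c i) → k ∣ (m : ℤ)) :
    Nonempty ((powProdHom (M := M) c).ker ≃*
      (torsionSub M m × (Fin (r - 1) → M))) := by
  obtain ⟨n, rfl⟩ : ∃ n, r = n + 1 := ⟨r - 1, by omega⟩
  obtain ⟨g, φ, hg, hφ⟩ := exists_mulEquiv_powProdHom_eq M n c
  have hgm : g ∣ m := hm₂ g ((hg g).mp dvd_rfl)
  have hmg : (m : ℤ) ∣ g := (hg m).mpr hm₁
  have key (y : M) : y ^ g = 1 ↔ y ^ m = 1 := by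
    rw [← zpow_natCast, ← orderOf_dvd_iff_zpow_eq_one, ← orderOf_dvd_iff_zpow_eq_one]
    exact ⟨fun h => h.trans hgm, fun h => h.trans hmg⟩
  have hker (x : Fin (n + 1) → M) : x ∈ (powProdHom c).ker ↔ (φ x).1 ∈ torsionSub M m := by
    rw [MonoidHom.mem_ker, hφ]
    exact key _
  exact ⟨{
    toFun := fun x => (⟨(φ x).1, (hker x).mp x.2⟩, (φ x).2)
    invFun := fun p => ⟨φ.symm (p.1, p.2), (hker _).mpr (by simp)⟩
    left_inv := fun x => by simp
    right_inv := fun p => by simp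
    map_mul' := fun x y => by ext <;> simp }⟩
end
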